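/- Let f, g : [0,T] → V be functions into a real normed space V, let δ > 0 and let 0 ≤ t₁ ≤ t ≤ t₂ ≤ T with t₂ − t₁ ≤ δ. Then M(f(t₁) + g(t₁), f(t) + g(t), f(t₂) + g(t₂)) ≤ M(f(t₁), f(t), f(t₂)) + sup{ ‖g(s₁) − g(s₂)‖ : s₁, s₂ ∈ [0,T], |s₂ − s₁| ≤ δ }. -/

import Mathlib

/-- Distance from `v` to the segment joining `v₁` and `v₂`:
`M(v₁, v, v₂) = inf_{α ∈ [0,1]} ‖v − (α v₁ + (1 − α) v₂)‖`. -/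
noncomputable def segDist {V : Type*} [NormedAddCommGroup V] [NormedSpace ℝ V]
    (v₁ v v₂ : V) : ℝ :=
  sInf {d : ℝ | ∃ α ∈ Set.Icc (0:ℝ) 1, d = ‖v - (α • v₁ + (1 - α) • v₂)‖}

theorem segDist_le_norm {V : Type*} [NormedAddCommGroup V] [NormedSpace ℝ V]
    (v₁ v v₂ : V) {α : ℝ} (hα : α ∈ Set.Icc (0:ℝ) 1) :
    segDist v₁ v v₂ ≤ ‖v - (α • v₁ + (1 - α) • v₂)‖ :=
  csInf_le ⟨0, by rintro _ ⟨β, -, rfl⟩; exact norm_nonneg _⟩ ⟨α, hα, rfl⟩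

theorem segDist_add_le {V : Type*} [NormedAddCommGroup V] [NormedSpace ℝ V]
    {v₁ v v₂ w₁ w w₂ : V} {C : ℝ} (h₁ : ‖w - w₁‖ ≤ C) (h₂ : ‖w - w₂‖ ≤ C) :
    segDist (v₁ + w₁) (v + w) (v₂ + w₂) ≤ segDist v₁ v v₂ + C := by
  rw [← sub_le_iff_le_add]
  refine le_csInf ⟨_, 0, by simp, rfl⟩ ?_
  rintro _ ⟨α, hα, rfl⟩
  rw [sub_le_iff_le_add]
  have hw : ‖w - (α • w₁ + (1 - α) • w₂)‖ ≤ C := by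
    have hconv := convex_closedBall w C
    have hmem := hconv (x := w₁) (by rwa [mem_closedBall_iff_norm'])
      (y := w₂) (by rwa [mem_closedBall_iff_norm'])
      hα.1 (sub_nonneg.2 hα.2) (add_sub_cancel α 1)
    rwa [mem_closedBall_iff_norm'] at hmem
  calc
    segDist (v₁ + w₁) (v + w) (v₂ + w₂)
        ≤ ‖(v + w) - (α • (v₁ + w₁) + (1 - α) • (v₂ + w₂))‖ := segDist_le_norm _ _ _ hα
    _ = ‖(v - (α • v₁ + (1 - α) • v₂)) + (w - (α • w₁ + (1 - α) • w₂))‖ := by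
      congr 1
      module
    _ ≤ ‖v - (α • v₁ + (1 - α) • v₂)‖ + C := (norm_add_le _ _).trans (by gcongr)

/-- for `f, g : [0,T] → V`, `δ > 0` and `0 ≤ t₁ ≤ t ≤ t₂ ≤ T` with `t₂ − t₁ ≤ δ`,
`M(f(t₁)+g(t₁), f(t)+g(t), f(t₂)+g(t₂)) ≤ M(f(t₁), f(t), f(t₂)) +
  sup{ ‖g(s₁) − g(s₂)‖ : s₁, s₂ ∈ [0,T], |s₂ − s₁| ≤ δ }`. -/
theorem segDist_add_le_segDist_add_osc {V : Type*}
    [NormedAddCommGroup V] [NormedSpace ℝ V]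
    (T : ℝ) (hT : 0 < T) (f g : ℝ → V) (δ : ℝ) (hδ : 0 < δ) (t₁ t t₂ : ℝ)
    (h₀ : 0 ≤ t₁) (h₁ : t₁ ≤ t) (h₂ : t ≤ t₂) (h₃ : t₂ ≤ T) (hδ' : t₂ - t₁ ≤ δ)
    (hbdd : BddAbove {x : ℝ | ∃ s₁ ∈ Set.Icc (0:ℝ) T, ∃ s₂ ∈ Set.Icc (0:ℝ) T,
      |s₂ - s₁| ≤ δ ∧ x = ‖g s₁ - g s₂‖}) :
    segDist (f t₁ + g t₁) (f t + g t) (f t₂ + g t₂) ≤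
      segDist (f t₁) (f t) (f t₂) +
        sSup {x : ℝ | ∃ s₁ ∈ Set.Icc (0:ℝ) T, ∃ s₂ ∈ Set.Icc (0:ℝ) T,
          |s₂ - s₁| ≤ δ ∧ x = ‖g s₁ - g s₂‖} := by
  have ht : t ∈ Set.Icc (0:ℝ) T := ⟨h₀.trans h₁, h₂.trans h₃⟩
  refine segDist_add_le (le_csSup hbdd ?_) (le_csSup hbdd ?_)
  · exact ⟨t, ht, t₁, ⟨h₀, by linarith⟩, abs_le.2 ⟨by linarith, by linarith⟩, rfl⟩
  · exact ⟨t, ht, t₂, ⟨by linarith, h₃⟩, abs_le.2 ⟨by linarith, by linarith⟩, rfl⟩
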